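/- (Borel lemma for symbols.) Let m ∈ ℝ and, for each j ∈ ℕ₀, let ρ_{m−j} ∈ 𝕊^{m−j}(ℝⁿ;𝒜_θ). Then there exists a symbol ρ ∈ 𝕊^m(ℝⁿ;𝒜_θ) such that ρ ∼ Σ_{j≥0} ρ_{m−j}, i.e. ρ − Σ_{j<N} ρ_{m−j} ∈ 𝕊^{m−N}(ℝⁿ;𝒜_θ) for every N ≥ 1. Moreover, ρ is unique modulo 𝒮(ℝⁿ;𝒜_θ): if ρ' ∈ 𝕊^m(ℝⁿ;𝒜_θ) also satisfies ρ' ∼ Σ_{j≥0} ρ_{m−j}, then ρ − ρ' ∈ 𝒮(ℝⁿ;𝒜_θ). -/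

import Mathlib

open Complex Filter Topology
open scoped ComplexOrder Real BigOperators

noncomputable section

/-- Euclidean space `ℝⁿ`. -/
abbrev Rn (n : ℕ) : Type := EuclideanSpace ℝ (Fin n)

/-- `ℝⁿ × ℝⁿ`. -/
abbrev R2n (n : ℕ) : Type := Rn n × Rn n

/-- Length `|β|` of a multi-order `β ∈ ℕ₀ⁿ`. -/
def mdeg {n : ℕ} (b : Fin n → ℕ) : ℕ := ∑ j, b j

/-- Composition of a list of self-maps. -/
def compList {X : Type*} (l : List (X → X)) : X → X := l.foldr (· ∘ ·) id

/-- The phase `c(k,l) = Σ_{q<p} k_p θ_{pq} l_q`. -/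
def cPhase {n : ℕ} (θ : Matrix (Fin n) (Fin n) ℝ) (k l : Fin n → ℤ) : ℝ :=
  ∑ p, ∑ q, if q < p then (k p : ℝ) * θ p q * (l q : ℝ) else 0

/-- Euclidean norm `|k|` of a lattice point `k ∈ ℤⁿ`. -/
def znorm {n : ℕ} (k : Fin n → ℤ) : ℝ := Real.sqrt (∑ j, ((k j : ℝ)) ^ 2)

/-- `k^β = ∏ k_jᵝ`. -/
def kpow {n : ℕ} (b : Fin n → ℕ) (k : Fin n → ℤ) : ℝ := ∏ j, ((k j : ℝ)) ^ (b j)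

/-- A lattice point `k ∈ ℤⁿ` viewed as a point of `ℝⁿ`. -/
def zEmb {n : ℕ} (k : Fin n → ℤ) : Rn n := (WithLp.equiv 2 (Fin n → ℝ)).symm (fun j => (k j : ℝ))

variable {n : ℕ} {A : Type} [NormedRing A] [StarRing A] [CStarRing A]
  [NormedAlgebra ℂ A] [StarModule ℂ A] [CompleteSpace A]

/-- The derivation `δ_j u = (1/i) ∂_{s_j} α_s(u)|_{s=0}`. -/
def δd (αa : Rn n → (A ≃⋆ₐ[ℂ] A)) (j : Fin n) (u : A) : A :=
  (-Complex.I) • fderiv ℝ (fun s : Rn n => αa s u) 0 (EuclideanSpace.single j 1)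

/-- `δ^β = δ_1^{β_1} ⋯ δ_n^{β_n}`. -/
def δpow (αa : Rn n → (A ≃⋆ₐ[ℂ] A)) (b : Fin n → ℕ) : A → A :=
  compList (List.ofFn fun j => (δd αa j)^[b j])

/-- The smooth noncommutative torus `𝒜_θ`: elements with `C^∞` orbit map. -/
def SmoothSet (αa : Rn n → (A ≃⋆ₐ[ℂ] A)) : Set A :=
  {u | ∀ N : ℕ, ContDiff ℝ N (fun s : Rn n => αa s u)}

/-- `A_θ^{(N)}`: elements with `C^N` orbit map. -/
def CNSet (αa : Rn n → (A ≃⋆ₐ[ℂ] A)) (N : ℕ) : Set A :=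
  {u | ContDiff ℝ N (fun s : Rn n => αa s u)}

/-- The Fréchet seminorms `‖u‖_{(N)} = sup_{|β| ≤ N} ‖δ^β(u)‖` of `𝒜_θ`. -/
def frSemi (αa : Rn n → (A ≃⋆ₐ[ℂ] A)) (N : ℕ) (u : A) : ℝ :=
  ⨆ b : {b : Fin n → ℕ // mdeg b ≤ N}, ‖δpow αa b.1 u‖

/-- Partial derivative `∂_{ξ_j}` of maps `ℝⁿ → A`. -/
def pd {n : ℕ} (j : Fin n) (f : Rn n → A) : Rn n → A :=
  fun ξ => fderiv ℝ f ξ (EuclideanSpace.single j 1)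

/-- Iterated partial derivative `∂_ξ^β` of maps `ℝⁿ → A`. -/
def pdPow {n : ℕ} (b : Fin n → ℕ) : (Rn n → A) → (Rn n → A) :=
  compList (List.ofFn fun j => (pd j)^[b j])

/-- Partial derivative `∂_{s_j}` (first variable) of maps `ℝⁿ×ℝⁿ → A`. -/
def pdS {n : ℕ} (j : Fin n) (f : R2n n → A) : R2n n → A :=
  fun x => fderiv ℝ f x (EuclideanSpace.single j 1, 0)

/-- Partial derivative `∂_{ξ_j}` (second variable) of maps `ℝⁿ×ℝⁿ → A`. -/
def pdXi {n : ℕ} (j : Fin n) (f : R2n n → A) : R2n n → A :=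
  fun x => fderiv ℝ f x (0, EuclideanSpace.single j 1)

/-- `∂_s^β`. -/
def pdSPow {n : ℕ} (b : Fin n → ℕ) : (R2n n → A) → (R2n n → A) :=
  compList (List.ofFn fun j => (pdS j)^[b j])

/-- `∂_ξ^γ`. -/
def pdXiPow {n : ℕ} (b : Fin n → ℕ) : (R2n n → A) → (R2n n → A) :=
  compList (List.ofFn fun j => (pdXi j)^[b j])

/-- Forward difference operator `Δ_j` on maps `ℝⁿ → A`. -/
def fdiff {n : ℕ} (j : Fin n) (f : Rn n → A) : Rn n → A :=
  fun ξ => f (ξ + EuclideanSpace.single j 1) - f ξ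

/-- `Δ^β` on maps `ℝⁿ → A`. -/
def fdiffPow {n : ℕ} (b : Fin n → ℕ) : (Rn n → A) → (Rn n → A) :=
  compList (List.ofFn fun j => (fdiff j)^[b j])

/-- Forward difference operator `Δ_j` on sequences `ℤⁿ → A`. -/
def zdiff {n : ℕ} (j : Fin n) (f : (Fin n → ℤ) → A) : (Fin n → ℤ) → A :=
  fun k => f (k + Pi.single j 1) - f k

/-- `Δ^β` on sequences `ℤⁿ → A`. -/
def zdiffPow {n : ℕ} (b : Fin n → ℕ) : ((Fin n → ℤ) → A) → ((Fin n → ℤ) → A) :=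
  compList (List.ofFn fun j => (zdiff j)^[b j])

/-- The symbol class `𝕊^m(ℝⁿ; 𝒜_θ)`. -/
def IsSymbol (αa : Rn n → (A ≃⋆ₐ[ℂ] A)) (m : ℝ) (ρ : Rn n → A) : Prop :=
  (∀ ξ, ρ ξ ∈ SmoothSet αa) ∧
  (∀ a : Fin n → ℕ, ∀ N : ℕ, ContDiff ℝ N fun ξ => δpow αa a (ρ ξ)) ∧
  (∀ a b : Fin n → ℕ, ∃ C > 0, ∀ ξ,
    ‖δpow αa a (pdPow b ρ ξ)‖ ≤ C * (1 + ‖ξ‖) ^ (m - (mdeg b : ℝ)))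

/-- The class `𝒮(ℝⁿ; 𝒜_θ) = ∩ₘ 𝕊^m(ℝⁿ; 𝒜_θ)`. -/
def IsSchwartzSym (αa : Rn n → (A ≃⋆ₐ[ℂ] A)) (ρ : Rn n → A) : Prop :=
  ∀ m : ℝ, IsSymbol αa m ρ

/-- The seminorm `p_N^{(m)}` on `𝕊^m(ℝⁿ; 𝒜_θ)`. -/
def pSemi (αa : Rn n → (A ≃⋆ₐ[ℂ] A)) (m : ℝ) (N : ℕ) (ρ : Rn n → A) : ℝ :=
  ⨆ q : {ab : (Fin n → ℕ) × (Fin n → ℕ) // mdeg ab.1 + mdeg ab.2 ≤ N} × Rn n,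
    (1 + ‖q.2‖) ^ (-m + (mdeg q.1.1.2 : ℝ)) * ‖δpow αa q.1.1.1 (pdPow q.1.1.2 ρ q.2)‖

/-- The amplitude class `A^m(ℝⁿ×ℝⁿ; 𝒜_θ)`. -/
def IsAmplitude (αa : Rn n → (A ≃⋆ₐ[ℂ] A)) (m : ℝ) (a : R2n n → A) : Prop :=
  (∀ x, a x ∈ SmoothSet αa) ∧
  (∀ c : Fin n → ℕ, ∀ N : ℕ, ContDiff ℝ N fun x => δpow αa c (a x)) ∧
  (∀ c b g : Fin n → ℕ, ∃ C > 0, ∀ x : R2n n,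
    ‖δpow αa c (pdSPow b (pdXiPow g a) x)‖ ≤ C * (1 + ‖x.1‖ + ‖x.2‖) ^ m)

/-- The seminorm `q_N^{(m)}` on `A^m(ℝⁿ×ℝⁿ; 𝒜_θ)`. -/
def qSemi (αa : Rn n → (A ≃⋆ₐ[ℂ] A)) (m : ℝ) (N : ℕ) (a : R2n n → A) : ℝ :=
  ⨆ q : {t : (Fin n → ℕ) × (Fin n → ℕ) × (Fin n → ℕ) //
      mdeg t.1 + mdeg t.2.1 + mdeg t.2.2 ≤ N} × R2n n,
    (1 + ‖q.2.1‖ + ‖q.2.2‖) ^ (-m) *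
      ‖δpow αa q.1.1.1 (pdSPow q.1.1.2.1 (pdXiPow q.1.1.2.2 a) q.2)‖

/-- The toroidal symbol class `𝕊^m(ℤⁿ; 𝒜_θ)`. -/
def IsToroidal (αa : Rn n → (A ≃⋆ₐ[ℂ] A)) (m : ℝ) (ρ : (Fin n → ℤ) → A) : Prop :=
  (∀ k, ρ k ∈ SmoothSet αa) ∧
  (∀ a b : Fin n → ℕ, ∃ C > 0, ∀ k,
    ‖δpow αa a (zdiffPow b ρ k)‖ ≤ C * (1 + znorm k) ^ (m - (mdeg b : ℝ)))

/-- The coefficient `(1-χ)/(|s|²+|ξ|²)` of the operator `L`. -/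
def Lcoef {n : ℕ} (χc : R2n n → ℝ) (x : R2n n) : ℝ := (1 - χc x) / (‖x.1‖ ^ 2 + ‖x.2‖ ^ 2)

/-- The transpose `L^t` of `L = χ + (1-χ)(|s|²+|ξ|²)^{-1} Σ (ξ_j D_{s_j} + s_j D_{ξ_j})`,
namely `L^t u = χ u - Σ_j (D_{s_j}((1-χ)(|s|²+|ξ|²)^{-1} ξ_j u) + D_{ξ_j}(… s_j u))`. -/
def Ltrans (χc : R2n n → ℝ) (u : R2n n → A) : R2n n → A := fun x =>
  χc x • u x -
    ∑ j, ((-Complex.I) • pdS j (fun y => (Lcoef χc y * y.2 j) • u y) x +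
      (-Complex.I) • pdXi j (fun y => (Lcoef χc y * y.1 j) • u y) x)

/-- The (regularized) oscillating integral `(2π)^{-n} ∬ e^{is·ξ} (L^t)^N[a(s,ξ)] ds dξ`. -/
def Josc (χc : R2n n → ℝ) (N : ℕ) (a : R2n n → A) : A :=
  ((2 * Real.pi) ^ n)⁻¹ •
    MeasureTheory.integral MeasureTheory.volume
      (fun x : R2n n => Complex.exp (Complex.I * ((∑ j, x.1 j * x.2 j : ℝ) : ℂ)) •
        ((Ltrans χc)^[N] a) x)

/-- A convenient integer `> m + 2n`. -/
def Nfor (n : ℕ) (m : ℝ) : ℕ := ⌈m⌉₊ + 2 * n + 1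


open scoped ContDiff

set_option linter.unusedSectionVars false

section Words

/-- The ordered product `D_1^{b_1} ⋯ D_n^{b_n}` of a family of self-maps. -/
def wordPow {n : ℕ} {X : Type*} (D : Fin n → X → X) (b : Fin n → ℕ) : X → X :=
  compList (List.ofFn fun j => (D j)^[b j])

variable {n : ℕ} {X Y : Type*} {D : Fin n → X → X} {D' : Fin n → Y → Y} {S : Set X}

theorem wordPow_eq_foldr (D : Fin n → X → X) (b : Fin n → ℕ) :
    wordPow D b = ((List.finRange n).map fun j => (D j)^[b j]).foldr (· ∘ ·) id := by
  rw [wordPow, compList, List.ofFn_eq_map]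

theorem iterate_mem_of_invariant {f : X → X} (h : ∀ u ∈ S, f u ∈ S) (k : ℕ) :
    ∀ u ∈ S, f^[k] u ∈ S := by
  induction k with
  | zero => simp
  | succ k ih => intro u hu; exact ih _ (h u hu)

theorem foldr_comp_mem (hS : ∀ i, ∀ u ∈ S, D i u ∈ S) (b : Fin n → ℕ) (L : List (Fin n)) :
    ∀ u ∈ S, (L.map fun j => (D j)^[b j]).foldr (· ∘ ·) id u ∈ S := by
  induction L with
  | nil => simp
  | cons i L ih => intro u hu; exact iterate_mem_of_invariant (hS i) _ _ (ih u hu)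

theorem iterate_semiconj_of_invariant {f : X → X} {g : Y → Y} {T : X → Y}
    (h : ∀ u ∈ S, f u ∈ S) (hT : ∀ u ∈ S, T (f u) = g (T u)) (k : ℕ) :
    ∀ u ∈ S, T (f^[k] u) = g^[k] (T u) := by
  induction k with
  | zero => simp
  | succ k ih =>
    intro u hu
    rw [Function.iterate_succ_apply, ih _ (h u hu), hT u hu, Function.iterate_succ_apply]

theorem foldr_comp_semiconj {T : X → Y} (hS : ∀ i, ∀ u ∈ S, D i u ∈ S)
    (hT : ∀ i, ∀ u ∈ S, T (D i u) = D' i (T u)) (b : Fin n → ℕ) (L : List (Fin n)) :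
    ∀ u ∈ S, T ((L.map fun j => (D j)^[b j]).foldr (· ∘ ·) id u) =
      (L.map fun j => (D' j)^[b j]).foldr (· ∘ ·) id (T u) := by
  induction L with
  | nil => simp
  | cons i L ih =>
    intro u hu
    have h1 := iterate_semiconj_of_invariant (hS i) (hT i) (b i) _ (foldr_comp_mem hS b L u hu)
    simp only [List.map_cons, List.foldr_cons, Function.comp_apply]
    rw [h1, ih u hu]

/-- A map intertwining `D` and `D'` on a `D`-invariant set intertwines their ordered products. -/
theorem wordPow_semiconj {T : X → Y} (hS : ∀ i, ∀ u ∈ S, D i u ∈ S)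
    (hT : ∀ i, ∀ u ∈ S, T (D i u) = D' i (T u)) (b : Fin n → ℕ) {u : X} (hu : u ∈ S) :
    T (wordPow D b u) = wordPow D' b (T u) := by
  rw [wordPow_eq_foldr, wordPow_eq_foldr]; exact foldr_comp_semiconj hS hT b _ u hu

theorem foldr_comp_add_single (hS : ∀ i, ∀ u ∈ S, D i u ∈ S)
    (hc : ∀ i j, ∀ u ∈ S, D i (D j u) = D j (D i u)) (b : Fin n → ℕ) (i : Fin n)
    (L : List (Fin n)) (hL : L.Nodup) (hi : i ∈ L) :
    ∀ u ∈ S, (L.map fun j => (D j)^[(b + Pi.single i 1 : Fin n → ℕ) j]).foldr (· ∘ ·) id u =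
      D i ((L.map fun j => (D j)^[b j]).foldr (· ∘ ·) id u) := by
  induction L with
  | nil => simp at hi
  | cons h L ih =>
    intro u hu
    have hn := (List.nodup_cons.1 hL).1
    simp only [List.map_cons, List.foldr_cons, Function.comp_apply]
    by_cases hih : i = h
    · subst hih
      have h2 : (L.map fun j => (D j)^[(b + Pi.single i 1 : Fin n → ℕ) j]) = L.map fun j => (D j)^[b j] := by
        apply List.map_congr_left
        intro j hj
        have : j ≠ i := fun h => hn (h ▸ hj)
        simp [this]
      rw [h2]
      simp only [Pi.add_apply, Pi.single_eq_same]
      rw [Function.iterate_succ_apply']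
    · have hi' : i ∈ L := by simpa [hih] using hi
      rw [ih (List.nodup_cons.1 hL).2 hi' u hu]
      have h0 : (b + Pi.single i 1 : Fin n → ℕ) h = b h := by simp [Ne.symm hih]
      rw [h0]
      exact (iterate_semiconj_of_invariant (T := D i) (hS h) (fun v hv => hc i h v hv) (b h) _
        (foldr_comp_mem hS b L u hu)).symm

theorem wordPow_add_single (hS : ∀ i, ∀ u ∈ S, D i u ∈ S)
    (hc : ∀ i j, ∀ u ∈ S, D i (D j u) = D j (D i u)) (b : Fin n → ℕ) (i : Fin n)
    {u : X} (hu : u ∈ S) : wordPow D (b + Pi.single i 1) u = wordPow D b (D i u) := by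
  rw [← wordPow_semiconj (T := D i) hS (fun j v hv => hc i j v hv) b hu, wordPow_eq_foldr,
    wordPow_eq_foldr]
  exact foldr_comp_add_single hS hc b i _ (List.nodup_finRange n) (List.mem_finRange i) u hu

end Words

section PartialDerivatives

theorem contDiff_pd {f : Rn n → A} (hf : ContDiff ℝ ∞ f) (j : Fin n) : ContDiff ℝ ∞ (pd j f) :=
  (hf.fderiv_right (m := ∞) le_rfl).clm_apply contDiff_const

theorem pd_pd_apply {f : Rn n → A} (hf : ContDiff ℝ ∞ f) (i j : Fin n) (ξ : Rn n) :
    pd i (pd j f) ξ =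
      fderiv ℝ (fderiv ℝ f) ξ (EuclideanSpace.single i 1) (EuclideanSpace.single j 1) := by
  have hd : DifferentiableAt ℝ (fderiv ℝ f) ξ :=
    ((hf.fderiv_right (m := ∞) le_rfl).differentiable (by simp)).differentiableAt
  change fderiv ℝ (fun ξ => fderiv ℝ f ξ (EuclideanSpace.single j 1)) ξ _ = _
  rw [fderiv_clm_apply hd (differentiableAt_const _)]
  simp

theorem pd_comm {f : Rn n → A} (hf : ContDiff ℝ ∞ f) (i j : Fin n) :
    pd i (pd j f) = pd j (pd i f) := by
  funext ξ
  rw [pd_pd_apply hf, pd_pd_apply hf]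
  exact (hf.contDiffAt.isSymmSndFDerivAt
    (by rw [minSmoothness_of_isRCLikeNormedField]
        exact ENat.LEInfty.out)) _ _

theorem norm_iteratedFDeriv_pd_le {f : Rn n → A} (hf : ContDiff ℝ ∞ f) (j : Fin n) (k : ℕ)
    (ξ : Rn n) : ‖iteratedFDeriv ℝ k (pd j f) ξ‖ ≤ ‖iteratedFDeriv ℝ (k + 1) f ξ‖ := by
  have h := (ContinuousLinearMap.apply ℝ A (EuclideanSpace.single j (1 : ℝ) : Rn n)
    ).norm_iteratedFDeriv_comp_left (n := k) (N := ∞) (x := ξ)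
    (hf.fderiv_right (m := ∞) le_rfl).contDiffAt (by exact_mod_cast le_top)
  rw [norm_iteratedFDeriv_fderiv] at h
  refine h.trans (mul_le_of_le_one_left (norm_nonneg _) ?_)
  refine ContinuousLinearMap.opNorm_le_bound _ zero_le_one fun L => ?_
  simpa using L.le_opNorm (EuclideanSpace.single j (1 : ℝ))

theorem fderiv_eq_sum_pd (f : Rn n → A) (ξ : Rn n) :
    fderiv ℝ f ξ = ∑ j, (EuclideanSpace.proj j : Rn n →L[ℝ] ℝ).smulRight (pd j f ξ) := by
  ext v
  have hv : v = ∑ j, v j • (EuclideanSpace.single j (1 : ℝ) : Rn n) := by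
    ext i; simp [Pi.single_apply]
  conv_lhs => rw [hv]
  simp [pd]

theorem norm_iteratedFDeriv_succ_le_sum_pd {f : Rn n → A} (hf : ContDiff ℝ ∞ f) (k : ℕ)
    (ξ : Rn n) :
    ‖iteratedFDeriv ℝ (k + 1) f ξ‖ ≤ ∑ j, ‖iteratedFDeriv ℝ k (pd j f) ξ‖ := by
  let Λ : Fin n → A →L[ℝ] (Rn n →L[ℝ] A) := fun j =>
    ContinuousLinearMap.smulRightL ℝ (Rn n) A (EuclideanSpace.proj j : Rn n →L[ℝ] ℝ)
  have hΛ : ∀ j, ‖Λ j‖ ≤ 1 := fun j => by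
    refine ContinuousLinearMap.opNorm_le_bound _ zero_le_one fun a => ?_
    refine ContinuousLinearMap.opNorm_le_bound _ (by positivity) fun v => ?_
    change ‖v j • a‖ ≤ 1 * ‖a‖ * ‖v‖
    rw [norm_smul, mul_comm, one_mul]
    exact mul_le_mul_of_nonneg_left (PiLp.norm_apply_le v j) (norm_nonneg _)
  have e : fderiv ℝ f = fun ξ => ∑ j, (Λ j ∘ pd j f) ξ := by
    funext η
    rw [fderiv_eq_sum_pd]
    rfl
  rw [← norm_iteratedFDeriv_fderiv, e, iteratedFDeriv_fun_sum_apply]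
  · refine (norm_sum_le _ _).trans (Finset.sum_le_sum fun j _ => ?_)
    refine ((Λ j).norm_iteratedFDeriv_comp_left (N := ∞) (contDiff_pd hf j).contDiffAt
      (by exact_mod_cast le_top)).trans (mul_le_of_le_one_left (norm_nonneg _) (hΛ j))
  · intro j _
    exact ((Λ j).contDiff.comp (contDiff_pd hf j)).contDiffAt.of_le
      (by exact_mod_cast le_top)

end PartialDerivatives

section BanachSymbols

variable {E F : Type*} [NormedAddCommGroup E] [NormedSpace ℝ E]
  [NormedAddCommGroup F] [NormedSpace ℝ F]

/-- Symbols of order `p` with values in a Banach space. -/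
def IsBanachSymbol (p : ℝ) (f : E → F) : Prop :=
  ContDiff ℝ ∞ f ∧
    ∀ k : ℕ, ∃ C : ℝ, ∀ ξ, ‖iteratedFDeriv ℝ k f ξ‖ ≤ C * (1 + ‖ξ‖) ^ (p - (k : ℝ))

theorem one_le_one_add_norm (ξ : E) : 1 ≤ 1 + ‖ξ‖ := by linarith [norm_nonneg ξ]

theorem one_add_norm_pos (ξ : E) : 0 < 1 + ‖ξ‖ := by linarith [norm_nonneg ξ]

theorem le_abs_add_one_mul_rpow {x C p : ℝ} {ξ : E} (h : x ≤ C * (1 + ‖ξ‖) ^ p) :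
    x ≤ (|C| + 1) * (1 + ‖ξ‖) ^ p :=
  h.trans (mul_le_mul_of_nonneg_right (by linarith [le_abs_self C])
    (Real.rpow_nonneg (one_add_norm_pos ξ).le _))

theorem ContDiff.contDiffAt_natCast {f : E → F} (hf : ContDiff ℝ ∞ f) (k : ℕ) (ξ : E) :
    ContDiffAt ℝ k f ξ :=
  hf.contDiffAt.of_le (by exact_mod_cast le_top)

namespace IsBanachSymbol

theorem mono {p q : ℝ} {f : E → F} (hf : IsBanachSymbol p f) (hpq : p ≤ q) :
    IsBanachSymbol q f := by
  refine ⟨hf.1, fun k => ?_⟩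
  obtain ⟨C, hC⟩ := hf.2 k
  refine ⟨|C| + 1, fun ξ => (le_abs_add_one_mul_rpow (hC ξ)).trans ?_⟩
  exact mul_le_mul_of_nonneg_left
    (Real.rpow_le_rpow_of_exponent_le (one_le_one_add_norm ξ) (by linarith)) (by positivity)

theorem add {p : ℝ} {f g : E → F} (hf : IsBanachSymbol p f) (hg : IsBanachSymbol p g) :
    IsBanachSymbol p (f + g) := by
  refine ⟨hf.1.add hg.1, fun k => ?_⟩
  obtain ⟨C, hC⟩ := hf.2 k
  obtain ⟨C', hC'⟩ := hg.2 k
  refine ⟨C + C', fun ξ => ?_⟩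
  rw [iteratedFDeriv_add_apply (hf.1.contDiffAt_natCast k ξ) (hg.1.contDiffAt_natCast k ξ), add_mul]
  exact (norm_add_le _ _).trans (add_le_add (hC ξ) (hC' ξ))

theorem neg {p : ℝ} {f : E → F} (hf : IsBanachSymbol p f) : IsBanachSymbol p (-f) := by
  refine ⟨hf.1.neg, fun k => ?_⟩
  obtain ⟨C, hC⟩ := hf.2 k
  refine ⟨C, fun ξ => ?_⟩
  rw [iteratedFDeriv_neg, Pi.neg_apply, norm_neg]
  exact hC ξ

theorem sub {p : ℝ} {f g : E → F} (hf : IsBanachSymbol p f) (hg : IsBanachSymbol p g) :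
    IsBanachSymbol p (f - g) := by
  rw [sub_eq_add_neg]; exact hf.add hg.neg

theorem const (c : F) : IsBanachSymbol 0 (fun _ : E => c) := by
  refine ⟨contDiff_const, fun k => ?_⟩
  rcases k.eq_zero_or_pos with rfl | hk
  · exact ⟨‖c‖, fun ξ => by simp⟩
  · exact ⟨0, fun ξ => by simp [iteratedFDeriv_const_of_ne hk.ne']⟩

theorem of_hasCompactSupport {f : E → F} (hf : ContDiff ℝ ∞ f) (hc : HasCompactSupport f)
    (p : ℝ) : IsBanachSymbol p f := by
  refine ⟨hf, fun k => ?_⟩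
  let w : E → ℝ := fun ξ => (1 + ‖ξ‖) ^ (-(p - k))
  have hw : Continuous w := (continuous_const.add continuous_norm).rpow_const
    fun ξ => Or.inl (one_add_norm_pos ξ).ne'
  have hcont : Continuous (w • iteratedFDeriv ℝ k f) :=
    hw.smul (hf.continuous_iteratedFDeriv (by exact_mod_cast le_top))
  obtain ⟨C, hC⟩ := ((hc.iteratedFDeriv (𝕜 := ℝ) k).smul_left (f := w)).exists_bound_of_continuous
    hcont
  refine ⟨C, fun ξ => ?_⟩
  have h := hC ξ
  have hpos := Real.rpow_pos_of_pos (one_add_norm_pos ξ) (p - k)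
  rw [Pi.smul_apply', norm_smul, Real.norm_of_nonneg (Real.rpow_nonneg (one_add_norm_pos ξ).le _),
    Real.rpow_neg (one_add_norm_pos ξ).le, inv_mul_le_iff₀ hpos] at h
  linarith

end IsBanachSymbol

theorem norm_iteratedFDeriv_comp_smul_le {χ : E → ℝ} (hχ : ContDiff ℝ ∞ χ) {k : ℕ} {C : ℝ}
    (hC : ∀ ξ, ‖iteratedFDeriv ℝ k χ ξ‖ ≤ C * (1 + ‖ξ‖) ^ (0 - (k : ℝ)))
    {ε : ℝ} (h0 : 0 < ε) (h1 : ε ≤ 1) (ξ : E) :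
    ‖iteratedFDeriv ℝ k (fun ξ => χ (ε • ξ)) ξ‖ ≤ C * (1 + ‖ξ‖) ^ (0 - (k : ℝ)) := by
  have hC0 : 0 ≤ C := by simpa using (norm_nonneg _).trans (hC 0)
  have h : ContDiff ℝ k χ := hχ.of_le (by exact_mod_cast le_top)
  rw [iteratedFDeriv_comp_const_smul ε h, norm_smul, norm_pow, Real.norm_of_nonneg h0.le]
  refine (mul_le_mul_of_nonneg_left (hC (ε • ξ)) (by positivity)).trans ?_
  rw [mul_left_comm]
  refine mul_le_mul_of_nonneg_left ?_ hC0
  rw [zero_sub, Real.rpow_neg (one_add_norm_pos _).le, Real.rpow_neg (one_add_norm_pos _).le,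
    Real.rpow_natCast, Real.rpow_natCast, norm_smul, Real.norm_of_nonneg h0.le,
    ← div_eq_mul_inv, div_le_iff₀ (by positivity), inv_mul_eq_div, le_div_iff₀ (by positivity),
    ← mul_pow]
  refine pow_le_pow_left₀ (by positivity) ?_ _
  nlinarith [norm_nonneg ξ]

/-- Cutting off a symbol of order `p` away from a large ball makes it small of order `p + 1`. -/
theorem IsBanachSymbol.eventually_cutoff_le {χ : E → ℝ} (hχ : IsBanachSymbol 0 χ)
    (hχ0 : ∀ ξ, ‖ξ‖ < 1 → χ ξ = 0) {p : ℝ} {f : E → F} (hf : IsBanachSymbol p f) (k : ℕ)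
    {η : ℝ} (hη : 0 < η) :
    ∀ᶠ ε in 𝓝[>] (0 : ℝ), ∀ ξ, ‖iteratedFDeriv ℝ k (fun ξ => χ (ε • ξ) • f ξ) ξ‖ ≤
      η * (1 + ‖ξ‖) ^ (p + 1 - (k : ℝ)) := by
  choose B hB using hχ.2
  choose C hC using hf.2
  set K : ℝ := ∑ i ∈ Finset.range (k + 1), (k.choose i : ℝ) * B i * C (k - i) with hK
  have hunif : ∀ ε : ℝ, 0 < ε → ε ≤ 1 → ∀ ξ,
      ‖iteratedFDeriv ℝ k (fun ξ => χ (ε • ξ) • f ξ) ξ‖ ≤ K * (1 + ‖ξ‖) ^ (p - (k : ℝ)) := by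
    intro ε h0 h1 ξ
    have hχε : ContDiff ℝ ∞ fun ξ : E => χ (ε • ξ) := hχ.1.comp (contDiff_const_smul ε)
    refine (norm_iteratedFDeriv_smul_le hχε hf.1 ξ (by exact_mod_cast le_top)).trans ?_
    rw [hK, Finset.sum_mul]
    refine Finset.sum_le_sum fun i hi => ?_
    have hi' : i ≤ k := Nat.lt_succ_iff.1 (Finset.mem_range.1 hi)
    have e : (1 + ‖ξ‖) ^ (p - (k : ℝ)) =
        (1 + ‖ξ‖) ^ (0 - (i : ℝ)) * (1 + ‖ξ‖) ^ (p - ((k - i : ℕ) : ℝ)) := by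
      rw [← Real.rpow_add (one_add_norm_pos ξ), Nat.cast_sub hi']
      ring_nf
    rw [e]
    have hb := norm_iteratedFDeriv_comp_smul_le hχ.1 (hB i) h0 h1 ξ
    calc _ ≤ (k.choose i : ℝ) * (B i * (1 + ‖ξ‖) ^ (0 - (i : ℝ))) *
          (C (k - i) * (1 + ‖ξ‖) ^ (p - ((k - i : ℕ) : ℝ))) :=
        mul_le_mul (mul_le_mul_of_nonneg_left hb (by positivity)) (hC _ ξ) (norm_nonneg _)
          (mul_nonneg (by positivity) ((norm_nonneg _).trans hb))
      _ = _ := by ring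
  have hKp : 0 < |K| + 1 := by positivity
  filter_upwards [Ioc_mem_nhdsGT (show (0 : ℝ) < min 1 (η / (|K| + 1)) by positivity)]
    with ε hε ξ
  obtain ⟨h0, h1⟩ := hε
  have hε1 : ε ≤ 1 := h1.trans (min_le_left _ _)
  have hεη : (|K| + 1) * ε ≤ η := by
    have := h1.trans (min_le_right _ _)
    rwa [le_div_iff₀ hKp, mul_comm] at this
  rcases lt_or_ge (ε * ‖ξ‖) 1 with hlt | hge
  · have hev : (fun ξ => χ (ε • ξ) • f ξ) =ᶠ[𝓝 ξ] fun _ => (0 : F) := by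
      have : ∀ᶠ ξ' in 𝓝 ξ, ε * ‖ξ'‖ < 1 :=
        (continuous_const.mul continuous_norm).continuousAt.eventually_lt_const hlt
      filter_upwards [this] with ξ' h'
      rw [hχ0 _ (by rwa [norm_smul, Real.norm_of_nonneg h0.le]), zero_smul]
    rw [(hev.iteratedFDeriv (𝕜 := ℝ) k).eq_of_nhds, iteratedFDeriv_fun_zero]
    simp only [Pi.zero_apply, norm_zero]
    exact mul_nonneg hη.le (Real.rpow_nonneg (one_add_norm_pos ξ).le _)
  · refine (le_abs_add_one_mul_rpow (hunif ε h0 hε1 ξ)).trans ?_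
    rw [show p + 1 - (k : ℝ) = (p - k) + 1 by ring, Real.rpow_add_one (one_add_norm_pos ξ).ne']
    have hr := Real.rpow_pos_of_pos (one_add_norm_pos ξ) (p - (k : ℝ))
    have h2 : |K| + 1 ≤ η * (1 + ‖ξ‖) := by
      have : (|K| + 1) * 1 ≤ (|K| + 1) * (ε * ‖ξ‖) := mul_le_mul_of_nonneg_left hge hKp.le
      nlinarith [norm_nonneg ξ]
    nlinarith

/-- A locally finite sum of symbols whose tails are small is a symbol. -/
theorem IsBanachSymbol.of_locallyFinite_sum {p : ℝ} {g : ℕ → E → F} {f : E → F} {J₀ : ℕ}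
    (hg : ∀ j, IsBanachSymbol p (g j))
    (hsmall : ∀ k : ℕ, ∃ M, ∀ j, M ≤ j → ∀ ξ,
      ‖iteratedFDeriv ℝ k (g j) ξ‖ ≤ (1 / 2) ^ j * (1 + ‖ξ‖) ^ (p - (k : ℝ)))
    (hf : ∀ J : ℕ, J₀ ≤ J → ∀ ξ, ‖ξ‖ < J → f ξ = ∑ j ∈ Finset.range J, g j ξ) :
    IsBanachSymbol p f := by
  have hev : ∀ J : ℕ, J₀ ≤ J → ∀ ξ, ‖ξ‖ < J →
      f =ᶠ[𝓝 ξ] fun ξ => ∑ j ∈ Finset.range J, g j ξ := by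
    intro J hJ ξ hξ
    filter_upwards [continuous_norm.continuousAt.eventually_lt_const hξ] with ξ' h'
    exact hf J hJ ξ' h'
  have hex : ∀ (M : ℕ) (ξ : E), ∃ J : ℕ, J₀ ≤ J ∧ M ≤ J ∧ ‖ξ‖ < J := fun M ξ => by
    obtain ⟨J, hJ⟩ := exists_nat_gt ‖ξ‖
    refine ⟨max J (max J₀ M), by simp, by simp, hJ.trans_le ?_⟩
    exact_mod_cast le_max_left _ _
  refine ⟨contDiff_iff_contDiffAt.2 fun ξ => ?_, fun k => ?_⟩
  · obtain ⟨J, hJ, -, hξ⟩ := hex 0 ξ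
    exact (ContDiff.sum fun j _ => (hg j).1).contDiffAt.congr_of_eventuallyEq (hev J hJ ξ hξ)
  · obtain ⟨M, hM⟩ := hsmall k
    choose C hC using fun j => (hg j).2 k
    refine ⟨∑ j ∈ Finset.range M, C j + 2, fun ξ => ?_⟩
    obtain ⟨J, hJ, hMJ, hξ⟩ := hex M ξ
    have hr := Real.rpow_pos_of_pos (one_add_norm_pos ξ) (p - (k : ℝ))
    rw [((hev J hJ ξ hξ).iteratedFDeriv (𝕜 := ℝ) k).eq_of_nhds,
      iteratedFDeriv_fun_sum_apply fun j _ => (hg j).1.contDiffAt_natCast k ξ]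
    refine (norm_sum_le _ _).trans ?_
    rw [← Finset.sum_range_add_sum_Ico _ hMJ, add_mul]
    refine add_le_add ?_ ?_
    · rw [Finset.sum_mul]
      exact Finset.sum_le_sum fun j _ => hC j ξ
    · refine (Finset.sum_le_sum fun j hj => hM j (Finset.mem_Ico.1 hj).1 ξ).trans ?_
      rw [← Finset.sum_mul]
      refine mul_le_mul_of_nonneg_right ?_ hr.le
      refine (Finset.sum_le_sum_of_subset_of_nonneg (t := Finset.range J) ?_ ?_).trans ?_
      · intro j hj; exact Finset.mem_range.2 (Finset.mem_Ico.1 hj).2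
      · intros; positivity
      · exact (Summable.sum_le_tsum _ (fun _ _ => by positivity)
          summable_geometric_two).trans tsum_geometric_two.le

/-- A smooth cutoff vanishing on the unit ball and equal to `1` outside a compact set. -/
theorem exists_cutoff (E : Type*) [NormedAddCommGroup E] [InnerProductSpace ℝ E]
    [FiniteDimensional ℝ E] :
    ∃ χ : E → ℝ, ContDiff ℝ ∞ χ ∧ (∀ ξ, ‖ξ‖ ≤ 1 → χ ξ = 0) ∧
      HasCompactSupport fun ξ => χ ξ - 1 := by
  let b : ContDiffBump (0 : E) := ⟨1, 2, one_pos, one_lt_two⟩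
  refine ⟨fun ξ => 1 - b ξ, contDiff_const.sub b.contDiff, fun ξ hξ => ?_, ?_⟩
  · simp [b.one_of_mem_closedBall (x := ξ) (by simpa [b] using hξ)]
  · have : (fun ξ => 1 - b ξ - 1) = -(b : E → ℝ) := by funext ξ; simp
    rw [this]
    exact b.hasCompactSupport.neg

end BanachSymbols

section PartialSymbols

theorem IsBanachSymbol.pd {p : ℝ} {f : Rn n → A} (hf : IsBanachSymbol p f) (j : Fin n) :
    IsBanachSymbol (p - 1) (pd j f) := by
  refine ⟨contDiff_pd hf.1 j, fun k => ?_⟩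
  obtain ⟨C, hC⟩ := hf.2 (k + 1)
  refine ⟨C, fun ξ => (norm_iteratedFDeriv_pd_le hf.1 j k ξ).trans ((hC ξ).trans_eq ?_)⟩
  push_cast
  ring_nf

theorem IsBanachSymbol.pd_iterate {f : Rn n → A} (j : Fin n) (k : ℕ) :
    ∀ {p : ℝ}, IsBanachSymbol p f → IsBanachSymbol (p - k) ((_root_.pd j)^[k] f) := by
  induction k with
  | zero => intro p hf; simpa using hf
  | succ k ih =>
    intro p hf
    rw [Function.iterate_succ_apply']
    have := (ih hf).pd j
    rwa [show p - ((k + 1 : ℕ) : ℝ) = p - k - 1 by push_cast; ring]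

theorem IsBanachSymbol.pdPow {p : ℝ} {f : Rn n → A} (hf : IsBanachSymbol p f) (b : Fin n → ℕ) :
    IsBanachSymbol (p - mdeg b) (pdPow b f) := by
  have key : ∀ L : List (Fin n), IsBanachSymbol (p - ((L.map b).sum : ℕ))
      ((L.map fun j => (_root_.pd j)^[b j]).foldr (· ∘ ·) id f) := by
    intro L
    induction L with
    | nil => simpa using hf
    | cons i L ih =>
      have := ih.pd_iterate i (b i)
      simp only [List.map_cons, List.foldr_cons, Function.comp_apply, List.sum_cons]
      rwa [show p - ((b i + (L.map b).sum : ℕ) : ℝ) = p - ((L.map b).sum : ℕ) - b i by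
        push_cast; ring]
  have h := key (List.finRange n)
  rw [← List.ofFn_eq_map, List.sum_ofFn, ← wordPow_eq_foldr] at h
  exact h

theorem contDiff_infty_pd_mem :
    ∀ i : Fin n, ∀ f ∈ {f : Rn n → A | ContDiff ℝ ∞ f}, pd i f ∈ {f : Rn n → A | ContDiff ℝ ∞ f} :=
  fun i _ hf => contDiff_pd hf i

theorem wordPow_zero {X : Type*} (D : Fin n → X → X) : wordPow D 0 = id := by
  rw [wordPow_eq_foldr]
  induction List.finRange n with
  | nil => rfl
  | cons i L ih => simp only [List.map_cons, List.foldr_cons, ih]; rfl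

theorem mdeg_zero : mdeg (0 : Fin n → ℕ) = 0 := by simp [mdeg]

theorem mdeg_add_single (b : Fin n → ℕ) (i : Fin n) : mdeg (b + Pi.single i 1) = mdeg b + 1 := by
  simp [mdeg, Finset.sum_add_distrib]

theorem isBanachSymbol_of_pdPow {p : ℝ} {f : Rn n → A} (hf : ContDiff ℝ ∞ f)
    (h : ∀ b, ∃ C : ℝ, ∀ ξ, ‖pdPow b f ξ‖ ≤ C * (1 + ‖ξ‖) ^ (p - (mdeg b : ℝ))) :
    IsBanachSymbol p f := by
  refine ⟨hf, fun k => ?_⟩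
  induction k generalizing p f with
  | zero =>
    obtain ⟨C, hC⟩ := h 0
    refine ⟨C, fun ξ => ?_⟩
    rw [norm_iteratedFDeriv_zero]
    have := hC ξ
    change ‖wordPow pd 0 f ξ‖ ≤ _ at this
    rw [wordPow_zero] at this
    simpa [mdeg_zero] using this
  | succ k ih =>
    have hstep : ∀ j, ∃ C : ℝ, ∀ ξ,
        ‖iteratedFDeriv ℝ k (pd j f) ξ‖ ≤ C * (1 + ‖ξ‖) ^ (p - 1 - (k : ℝ)) := by
      intro j
      refine ih (contDiff_pd hf j) fun b => ?_
      obtain ⟨C, hC⟩ := h (b + Pi.single j 1)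
      refine ⟨C, fun ξ => ?_⟩
      have := hC ξ
      change ‖wordPow pd (b + Pi.single j 1) f ξ‖ ≤ _ at this
      rw [wordPow_add_single contDiff_infty_pd_mem (fun i j _ hg => pd_comm hg i j) b j hf,
        mdeg_add_single] at this
      refine this.trans_eq ?_
      push_cast
      ring_nf
    choose C hC using hstep
    refine ⟨∑ j, C j, fun ξ => (norm_iteratedFDeriv_succ_le_sum_pd hf k ξ).trans ?_⟩
    rw [Finset.sum_mul]
    refine Finset.sum_le_sum fun j _ => (hC j ξ).trans_eq ?_
    push_cast
    ring_nf

end PartialSymbols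

section Derivations

variable {αa : Rn n → (A ≃⋆ₐ[ℂ] A)}

/-- An action of `ℝⁿ` by isometric automorphisms. -/
structure IsIsometricAction (αa : Rn n → (A ≃⋆ₐ[ℂ] A)) : Prop where
  add : ∀ s t (u : A), αa (s + t) u = αa s (αa t u)
  zero : ∀ u : A, αa 0 u = u
  norm : ∀ s (u : A), ‖αa s u‖ = ‖u‖

/-- The orbit map `s ↦ α_s(u)`. -/
def orbit (αa : Rn n → (A ≃⋆ₐ[ℂ] A)) (u : A) : Rn n → A := fun s => αa s u

theorem contDiff_orbit {u : A} (hu : u ∈ SmoothSet αa) : ContDiff ℝ ∞ (orbit αa u) :=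
  contDiff_infty.2 hu

theorem mem_smoothSet_of_contDiff {u : A} (hu : ContDiff ℝ ∞ (orbit αa u)) : u ∈ SmoothSet αa :=
  contDiff_infty.1 hu

theorem differentiable_orbit {u : A} (hu : u ∈ SmoothSet αa) : Differentiable ℝ (orbit αa u) :=
  (contDiff_orbit hu).differentiable (by simp)

theorem orbit_smul_sum {ι : Type*} (s : Finset ι) (c : ι → ℝ) (u : ι → A) :
    orbit αa (∑ i ∈ s, c i • u i) = fun t => ∑ i ∈ s, c i • orbit αa (u i) t := by
  funext t
  simp only [orbit, map_sum]
  refine Finset.sum_congr rfl fun i _ => ?_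
  rw [← Complex.coe_smul, map_smul, Complex.coe_smul]

theorem orbit_smul_sub (c : ℝ) (u v : A) :
    orbit αa (c • (u - v)) = fun t => c • (orbit αa u t - orbit αa v t) := by
  funext t
  simp only [orbit]
  rw [← Complex.coe_smul, map_smul, map_sub, Complex.coe_smul]

theorem smul_sum_mem_smoothSet {ι : Type*} {s : Finset ι} (c : ι → ℝ) {u : ι → A}
    (hu : ∀ i, u i ∈ SmoothSet αa) : ∑ i ∈ s, c i • u i ∈ SmoothSet αa := by
  apply mem_smoothSet_of_contDiff
  rw [orbit_smul_sum]
  exact ContDiff.sum fun i _ => (contDiff_orbit (hu i)).const_smul (c i)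

theorem smul_sub_mem_smoothSet (c : ℝ) {u v : A} (hu : u ∈ SmoothSet αa) (hv : v ∈ SmoothSet αa) :
    c • (u - v) ∈ SmoothSet αa := by
  apply mem_smoothSet_of_contDiff
  rw [orbit_smul_sub]
  exact ((contDiff_orbit hu).sub (contDiff_orbit hv)).const_smul c

theorem δd_eq (j : Fin n) (u : A) : δd αa j u = (-Complex.I) • pd j (orbit αa u) 0 := rfl

theorem δd_smul_sum {ι : Type*} {s : Finset ι} (c : ι → ℝ) {u : ι → A}
    (hu : ∀ i, u i ∈ SmoothSet αa) (j : Fin n) :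
    δd αa j (∑ i ∈ s, c i • u i) = ∑ i ∈ s, c i • δd αa j (u i) := by
  have h : HasFDerivAt (orbit αa (∑ i ∈ s, c i • u i))
      (∑ i ∈ s, c i • fderiv ℝ (orbit αa (u i)) 0) 0 := by
    rw [orbit_smul_sum]
    exact HasFDerivAt.fun_sum fun i _ => ((differentiable_orbit (hu i) 0).hasFDerivAt.const_smul _)
  simp only [δd_eq, pd, h.fderiv]
  simp only [sum_apply, smul_apply, Finset.smul_sum]
  exact Finset.sum_congr rfl fun i _ => smul_comm _ _ _

theorem δd_smul_sub (c : ℝ) {u v : A} (hu : u ∈ SmoothSet αa) (hv : v ∈ SmoothSet αa)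
    (j : Fin n) : δd αa j (c • (u - v)) = c • (δd αa j u - δd αa j v) := by
  have h : HasFDerivAt (orbit αa (c • (u - v)))
      (c • (fderiv ℝ (orbit αa u) 0 - fderiv ℝ (orbit αa v) 0)) 0 := by
    rw [orbit_smul_sub]
    exact ((differentiable_orbit hu 0).hasFDerivAt.sub
      (differentiable_orbit hv 0).hasFDerivAt).const_smul c
  simp only [δd_eq, pd, h.fderiv]
  simp only [sub_apply, smul_apply]
  rw [smul_comm, smul_sub]

namespace IsIsometricAction

variable (hα : IsIsometricAction αa)
include hα

theorem continuous (s : Rn n) : Continuous (αa s) :=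
  (AddMonoidHomClass.isometry_of_norm (αa s) (hα.norm s)).continuous

/-- Differentiating an orbit map amounts to applying the derivations. -/
theorem orbit_δd {u : A} (hu : u ∈ SmoothSet αa) (j : Fin n) :
    orbit αa (δd αa j u) = fun s => (-Complex.I) • pd j (orbit αa u) s := by
  funext s
  let L : A →L[ℝ] A := (AddMonoidHomClass.toAddMonoidHom (αa s)).toRealLinearMap (hα.continuous s)
  have h1 : HasFDerivAt (fun t => orbit αa u (s + t)) (fderiv ℝ (orbit αa u) s) 0 := by
    have h : HasFDerivAt (orbit αa u) (fderiv ℝ (orbit αa u) s) (s + 0) := by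
      rw [add_zero]; exact (differentiable_orbit hu s).hasFDerivAt
    exact h.comp (0 : Rn n) ((hasFDerivAt_id (0 : Rn n)).const_add s)
  have h2 : HasFDerivAt (fun t => orbit αa u (s + t)) (L.comp (fderiv ℝ (orbit αa u) 0)) 0 := by
    have h := L.hasFDerivAt.comp (0 : Rn n) (differentiable_orbit hu 0).hasFDerivAt
    have e : (fun t => orbit αa u (s + t)) = L ∘ orbit αa u := by
      funext t
      exact hα.add s t u
    rw [e]
    exact h
  have h3 := congrArg (fun l : Rn n →L[ℝ] A => l (EuclideanSpace.single j 1)) (h1.unique h2)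
  simp only [orbit, δd_eq]
  rw [map_smul]
  exact congrArg _ h3.symm

theorem δd_mem {u : A} (hu : u ∈ SmoothSet αa) (j : Fin n) : δd αa j u ∈ SmoothSet αa := by
  apply mem_smoothSet_of_contDiff
  rw [hα.orbit_δd hu]
  exact (contDiff_pd (contDiff_orbit hu) j).const_smul (-Complex.I)

theorem δd_δd {u : A} (hu : u ∈ SmoothSet αa) (i j : Fin n) :
    δd αa i (δd αa j u) = (-Complex.I) • (-Complex.I) • pd i (pd j (orbit αa u)) 0 := by
  have hd : DifferentiableAt ℝ (pd j (orbit αa u)) 0 :=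
    ((contDiff_pd (contDiff_orbit hu) j).differentiable (by simp)).differentiableAt
  have h := hd.hasFDerivAt.const_smul (-Complex.I)
  rw [δd_eq, hα.orbit_δd hu]
  exact congrArg _ (congrArg (fun l : Rn n →L[ℝ] A => l (EuclideanSpace.single i 1)) h.fderiv)

theorem δd_comm {u : A} (hu : u ∈ SmoothSet αa) (i j : Fin n) :
    δd αa i (δd αa j u) = δd αa j (δd αa i u) := by
  rw [hα.δd_δd hu, hα.δd_δd hu, pd_comm (contDiff_orbit hu)]

theorem δd_invariant : ∀ i, ∀ u ∈ SmoothSet αa, δd αa i u ∈ SmoothSet αa :=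
  fun i _ hu => hα.δd_mem hu i

theorem δpow_δd {u : A} (hu : u ∈ SmoothSet αa) (a : Fin n → ℕ) (j : Fin n) :
    δpow αa a (δd αa j u) = δpow αa (a + Pi.single j 1) u :=
  (wordPow_add_single hα.δd_invariant (fun i j _ hv => hα.δd_comm hv i j) a j hu).symm

/-- `δ^a` is real-linear on smooth elements. -/
theorem δpow_smul_sum {ι : Type*} {s : Finset ι} (c : ι → ℝ) {u : ι → A}
    (hu : ∀ i, u i ∈ SmoothSet αa) (a : Fin n → ℕ) :
    δpow αa a (∑ i ∈ s, c i • u i) = ∑ i ∈ s, c i • δpow αa a (u i) := by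
  have hinv : ∀ j, ∀ v ∈ {v : ι → A | ∀ i, v i ∈ SmoothSet αa},
      (fun i => δd αa j (v i)) ∈ {v : ι → A | ∀ i, v i ∈ SmoothSet αa} :=
    fun j v hv i => hα.δd_mem (hv i) j
  have h1 := wordPow_semiconj (D := fun j (v : ι → A) i => δd αa j (v i)) (D' := δd αa)
    (T := fun v => ∑ i ∈ s, c i • v i) hinv (fun j v hv => (δd_smul_sum c hv j).symm) a hu
  have h2 : ∀ i, wordPow (fun j (v : ι → A) i => δd αa j (v i)) a u i = δpow αa a (u i) :=
    fun i => wordPow_semiconj (D' := δd αa) (T := fun v : ι → A => v i) hinv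
      (fun _ _ _ => rfl) a hu
  rw [← Finset.sum_congr rfl fun i _ => congrArg (c i • ·) (h2 i)]
  exact h1.symm

end IsIsometricAction

end Derivations

section SmoothFamilies

variable {αa : Rn n → (A ≃⋆ₐ[ℂ] A)}

/-- The linear map `v ↦ ∑ j, v_j x_j`. -/
def coordSum (x : Fin n → A) : Rn n →L[ℝ] A :=
  ∑ j, (EuclideanSpace.proj j : Rn n →L[ℝ] ℝ).smulRight (x j)

theorem coordSum_apply (x : Fin n → A) (v : Rn n) : coordSum x v = ∑ j, v j • x j := by
  simp [coordSum]

theorem coordSum_sub (x y : Fin n → A) : coordSum x - coordSum y = coordSum (x - y) := by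
  ext v
  simp [coordSum_apply, smul_sub]

theorem coordSum_apply_single (x : Fin n → A) (j : Fin n) :
    coordSum x (EuclideanSpace.single j 1) = x j := by
  simp [coordSum_apply]

theorem norm_coordSum_le (x : Fin n → A) : ‖coordSum x‖ ≤ ∑ j, ‖x j‖ := by
  refine ContinuousLinearMap.opNorm_le_bound _ (by positivity) fun v => ?_
  rw [coordSum_apply, Finset.sum_mul]
  refine (norm_sum_le _ _).trans (Finset.sum_le_sum fun j _ => ?_)
  rw [norm_smul, mul_comm]
  exact mul_le_mul_of_nonneg_left (PiLp.norm_apply_le v j) (norm_nonneg _)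

theorem contDiff_coordSum {k : ℕ} {x : Rn n → Fin n → A} (hx : ∀ j, ContDiff ℝ k fun s => x s j) :
    ContDiff ℝ k fun s => coordSum (x s) :=
  ContDiff.sum fun j _ =>
    (ContinuousLinearMap.smulRightL ℝ (Rn n) A
      (EuclideanSpace.proj j : Rn n →L[ℝ] ℝ)).contDiff.comp (hx j)

/-- The smooth maps from `ℝⁿ` to the smooth noncommutative torus. -/
def SmoothFamily (αa : Rn n → (A ≃⋆ₐ[ℂ] A)) : Set (Rn n → A) :=
  {ρ | (∀ ξ, ρ ξ ∈ SmoothSet αa) ∧ ∀ a, ContDiff ℝ ∞ fun ξ => δpow αa a (ρ ξ)}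

/-- The derivation `δ_j` applied pointwise. -/
def δfun (αa : Rn n → (A ≃⋆ₐ[ℂ] A)) (j : Fin n) (ρ : Rn n → A) : Rn n → A :=
  fun ξ => δd αa j (ρ ξ)

theorem contDiff_of_mem_smoothFamily {ρ : Rn n → A} (hρ : ρ ∈ SmoothFamily αa) :
    ContDiff ℝ ∞ ρ := by
  have h := hρ.2 0
  simp only [show ∀ u, δpow αa 0 u = u from fun u => congrFun (wordPow_zero (δd αa)) u] at h
  exact h

theorem tendsto_slope_pd {f : Rn n → A} (hf : ContDiff ℝ ∞ f) (k : Fin n) (ξ : Rn n) :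
    Tendsto (fun h : ℝ => h⁻¹ • (f (ξ + h • EuclideanSpace.single k 1) - f ξ)) (𝓝[≠] 0)
      (𝓝 (pd k f ξ)) :=
  ((hf.differentiable (by simp) ξ).hasFDerivAt.hasLineDerivAt
    (EuclideanSpace.single k 1)).tendsto_slope_zero

namespace IsIsometricAction

variable (hα : IsIsometricAction αa)
include hα

theorem δfun_mem {ρ : Rn n → A} (hρ : ρ ∈ SmoothFamily αa) (j : Fin n) :
    δfun αa j ρ ∈ SmoothFamily αa := by
  refine ⟨fun ξ => hα.δd_mem (hρ.1 ξ) j, fun a => ?_⟩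
  simp only [δfun, hα.δpow_δd (hρ.1 _)]
  exact hρ.2 _

theorem hasFDerivAt_orbit {u : A} (hu : u ∈ SmoothSet αa) (s : Rn n) :
    HasFDerivAt (orbit αa u) (coordSum fun j => Complex.I • orbit αa (δd αa j u) s) s := by
  have e : (coordSum fun j => Complex.I • orbit αa (δd αa j u) s) = fderiv ℝ (orbit αa u) s := by
    simp only [hα.orbit_δd hu, smul_smul]
    rw [fderiv_eq_sum_pd]
    simp [coordSum]
  rw [e]
  exact (differentiable_orbit hu s).hasFDerivAt

theorem hasFDerivAt_orbit_pd {ρ : Rn n → A} (hρ : ρ ∈ SmoothFamily αa) (k : Fin n)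
    (ξ s : Rn n) : HasFDerivAt (orbit αa (pd k ρ ξ))
      (coordSum fun j => Complex.I • orbit αa (pd k (δfun αa j ρ) ξ) s) s := by
  let q : (Rn n → A) → ℝ → A := fun f h => h⁻¹ • (f (ξ + h • EuclideanSpace.single k 1) - f ξ)
  have hq : ∀ h, q ρ h ∈ SmoothSet αa := fun h => smul_sub_mem_smoothSet _ (hρ.1 _) (hρ.1 _)
  have hδq : ∀ j h, δd αa j (q ρ h) = q (δfun αa j ρ) h := fun j h =>
    δd_smul_sub _ (hρ.1 _) (hρ.1 _) j
  refine hasFDerivAt_of_tendstoUniformly (l := 𝓝[≠] (0 : ℝ)) (f := fun h => orbit αa (q ρ h))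
    (f' := fun h s => coordSum fun j => Complex.I • orbit αa (δd αa j (q ρ h)) s)
    (g' := fun s => coordSum fun j => Complex.I • orbit αa (pd k (δfun αa j ρ) ξ) s)
    ?_ (fun h s => hα.hasFDerivAt_orbit (hq h) s) ?_ s
  · have hlim : Tendsto (fun h => ∑ j, ‖pd k (δfun αa j ρ) ξ - q (δfun αa j ρ) h‖) (𝓝[≠] (0 : ℝ))
        (𝓝 0) := by
      have : Tendsto (fun h => ∑ j, ‖pd k (δfun αa j ρ) ξ - q (δfun αa j ρ) h‖) (𝓝[≠] (0 : ℝ))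
          (𝓝 (∑ j : Fin n, ‖pd k (δfun αa j ρ) ξ - pd k (δfun αa j ρ) ξ‖)) :=
        tendsto_finsetSum _ fun j _ => (tendsto_const_nhds.sub (tendsto_slope_pd
          (contDiff_of_mem_smoothFamily (hα.δfun_mem hρ j)) k ξ)).norm
      simpa using this
    rw [Metric.tendstoUniformly_iff]
    intro ε hε
    filter_upwards [hlim.eventually_lt_const hε] with h hh s
    rw [dist_eq_norm, coordSum_sub]
    refine (norm_coordSum_le _).trans_lt (lt_of_eq_of_lt ?_ hh)
    refine Finset.sum_congr rfl fun j _ => ?_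
    rw [Pi.sub_apply, ← smul_sub, norm_smul, Complex.norm_I, one_mul, hδq]
    simp only [orbit]
    rw [← map_sub, hα.norm]
  · intro s
    exact ((hα.continuous s).tendsto _).comp
      (tendsto_slope_pd (contDiff_of_mem_smoothFamily hρ) k ξ)

theorem contDiff_orbit_pd (N : ℕ) : ∀ {ρ : Rn n → A}, ρ ∈ SmoothFamily αa → ∀ (k : Fin n)
    (ξ : Rn n), ContDiff ℝ N (orbit αa (pd k ρ ξ)) := by
  induction N with
  | zero =>
    intro ρ hρ k ξ
    have : Continuous (orbit αa (pd k ρ ξ)) := continuous_iff_continuousAt.2 fun s =>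
      (hα.hasFDerivAt_orbit_pd hρ k ξ s).continuousAt
    exact contDiff_zero.2 this
  | succ N ih =>
    intro ρ hρ k ξ
    push_cast
    refine contDiff_succ_iff_hasFDerivAt.2 ⟨_, ?_, hα.hasFDerivAt_orbit_pd hρ k ξ⟩
    exact contDiff_coordSum fun j => (ih (hα.δfun_mem hρ j) k ξ).const_smul Complex.I

theorem pd_mem_smoothSet {ρ : Rn n → A} (hρ : ρ ∈ SmoothFamily αa) (k : Fin n) (ξ : Rn n) :
    pd k ρ ξ ∈ SmoothSet αa :=
  fun N => hα.contDiff_orbit_pd N hρ k ξ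

/-- The derivations commute with the partial derivatives in `ξ`. -/
theorem δfun_pd {ρ : Rn n → A} (hρ : ρ ∈ SmoothFamily αa) (j k : Fin n) :
    δfun αa j (pd k ρ) = pd k (δfun αa j ρ) := by
  funext ξ
  have h := (hα.hasFDerivAt_orbit_pd hρ k ξ 0).fderiv
  simp only [δfun, δd_eq]
  rw [pd, h, coordSum_apply_single, smul_smul]
  simp [orbit, hα.zero]

omit hα in
theorem wordPow_δfun (a : Fin n → ℕ) (ρ : Rn n → A) :
    wordPow (δfun αa) a ρ = fun ξ => δpow αa a (ρ ξ) := by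
  funext ξ
  exact wordPow_semiconj (S := Set.univ) (D' := δd αa) (T := fun ρ : Rn n → A => ρ ξ)
    (fun _ _ _ => trivial) (fun _ _ _ => rfl) a trivial

theorem δpow_pd {ρ : Rn n → A} (hρ : ρ ∈ SmoothFamily αa) (a : Fin n → ℕ) (k : Fin n) :
    (fun ξ => δpow αa a (pd k ρ ξ)) = pd k fun ξ => δpow αa a (ρ ξ) := by
  rw [← wordPow_δfun, ← wordPow_δfun]
  exact (wordPow_semiconj (T := pd k) (fun j _ h => hα.δfun_mem h j)
    (fun j _ h => (hα.δfun_pd h j k).symm) a hρ).symm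

theorem pd_mem {ρ : Rn n → A} (hρ : ρ ∈ SmoothFamily αa) (k : Fin n) :
    pd k ρ ∈ SmoothFamily αa := by
  refine ⟨hα.pd_mem_smoothSet hρ k, fun a => ?_⟩
  rw [hα.δpow_pd hρ]
  exact contDiff_pd (hρ.2 a) k

theorem δpow_pdPow {ρ : Rn n → A} (hρ : ρ ∈ SmoothFamily αa) (a b : Fin n → ℕ) :
    (fun ξ => δpow αa a (pdPow b ρ ξ)) = pdPow b fun ξ => δpow αa a (ρ ξ) :=
  wordPow_semiconj (T := fun (ρ : Rn n → A) ξ => δpow αa a (ρ ξ)) (fun k _ h => hα.pd_mem h k)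
    (fun k _ h => hα.δpow_pd h a k) b hρ

/-- A symbol is a map with smooth values all of whose derivations are Banach space valued
symbols. -/
theorem isSymbol_iff {m : ℝ} {ρ : Rn n → A} :
    IsSymbol αa m ρ ↔ (∀ ξ, ρ ξ ∈ SmoothSet αa) ∧
      ∀ a, IsBanachSymbol m fun ξ => δpow αa a (ρ ξ) := by
  constructor
  · rintro ⟨h1, h2, h3⟩
    have hρ : ρ ∈ SmoothFamily αa := ⟨h1, fun a => contDiff_infty.2 (h2 a)⟩
    refine ⟨h1, fun a => isBanachSymbol_of_pdPow (hρ.2 a) fun b => ?_⟩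
    obtain ⟨C, -, hC⟩ := h3 a b
    rw [← hα.δpow_pdPow hρ]
    exact ⟨C, hC⟩
  · rintro ⟨h1, h2⟩
    have hρ : ρ ∈ SmoothFamily αa := ⟨h1, fun a => (h2 a).1⟩
    refine ⟨h1, fun a => contDiff_infty.1 (h2 a).1, fun a b => ?_⟩
    obtain ⟨C, hC⟩ := ((h2 a).pdPow b).2 0
    refine ⟨|C| + 1, by positivity, fun ξ => ?_⟩
    have h := le_abs_add_one_mul_rpow (hC ξ)
    rw [norm_iteratedFDeriv_zero, ← hα.δpow_pdPow hρ] at h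
    simpa using h

end IsIsometricAction

end SmoothFamilies

section BorelSummation

variable {E F : Type*} [NormedAddCommGroup E] [NormedSpace ℝ E] [FiniteDimensional ℝ E]
  [NormedAddCommGroup F] [NormedSpace ℝ F]

theorem IsBanachSymbol.of_cutoff {χ : E → ℝ} (hχ : ContDiff ℝ ∞ χ)
    (hc : HasCompactSupport fun ξ => χ ξ - 1) : IsBanachSymbol 0 χ := by
  convert (IsBanachSymbol.of_hasCompactSupport (hχ.sub contDiff_const) hc 0).add
    (IsBanachSymbol.const (1 : ℝ)) using 1
  funext ξ
  simp

theorem IsBanachSymbol.cutoff_sub_one_smul {χ : E → ℝ} (hχ : ContDiff ℝ ∞ χ)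
    (hc : HasCompactSupport fun ξ => χ ξ - 1) {ε : ℝ} (hε : ε ≠ 0) {f : E → F}
    (hf : ContDiff ℝ ∞ f) (p : ℝ) : IsBanachSymbol p fun ξ => (χ (ε • ξ) - 1) • f ξ := by
  refine IsBanachSymbol.of_hasCompactSupport
    (((hχ.comp (contDiff_const_smul ε)).sub contDiff_const).smul hf) ?_ p
  exact (hc.comp_homeomorph (Homeomorph.smulOfNeZero ε hε)).smul_right

theorem IsBanachSymbol.exists_cutoff_scales {ι : Type*} [Encodable ι] {χ : E → ℝ}
    (hχ : IsBanachSymbol 0 χ) (hχ0 : ∀ ξ, ‖ξ‖ < 1 → χ ξ = 0) {m : ℝ} {f : ι → ℕ → E → F}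
    (hf : ∀ a (j : ℕ), IsBanachSymbol (m - (j : ℝ)) (f a j)) :
    ∃ ε : ℕ → ℝ, (∀ j, 0 < ε j ∧ ε j ≤ 1 / ((j : ℝ) + 1)) ∧
      ∀ a k j, Encodable.encode a ≤ j → k ≤ j → ∀ ξ,
        ‖iteratedFDeriv ℝ k (fun ξ => χ (ε j • ξ) • f a j ξ) ξ‖ ≤
          (1 / 2) ^ j * (1 + ‖ξ‖) ^ (m - (j : ℝ) + 1 - (k : ℝ)) := by
  have key : ∀ j : ℕ, ∃ ε : ℝ, (0 < ε ∧ ε ≤ 1 / ((j : ℝ) + 1)) ∧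
      ∀ a ∈ {a : ι | Encodable.encode a ≤ j}, ∀ k ∈ Set.Iic j, ∀ ξ,
        ‖iteratedFDeriv ℝ k (fun ξ => χ (ε • ξ) • f a j ξ) ξ‖ ≤
          (1 / 2) ^ j * (1 + ‖ξ‖) ^ (m - (j : ℝ) + 1 - (k : ℝ)) := by
    intro j
    have hfin : {a : ι | Encodable.encode a ≤ j}.Finite :=
      (Set.finite_Iic j).preimage Encodable.encode_injective.injOn
    have hpos : (0 : ℝ) < 1 / ((j : ℝ) + 1) := by positivity
    have h1 : ∀ᶠ ε in 𝓝[>] (0 : ℝ), 0 < ε ∧ ε ≤ 1 / ((j : ℝ) + 1) :=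
      Filter.eventually_of_mem (Ioc_mem_nhdsGT hpos) fun _ h => h
    exact (h1.and ((eventually_all_finite hfin).2 fun a _ =>
      (eventually_all_finite (Set.finite_Iic j)).2 fun k _ =>
        hχ.eventually_cutoff_le hχ0 (hf a j) k (by positivity))).exists
  choose ε h1 h2 using key
  exact ⟨ε, h1, fun a k j ha hk => h2 j a ha k hk⟩

theorem IsBanachSymbol.of_cutoff_sum {χ : E → ℝ} (hχ : ContDiff ℝ ∞ χ)
    (hc : HasCompactSupport fun ξ => χ ξ - 1) {m : ℝ} {f : ℕ → E → F}
    (hf : ∀ j : ℕ, IsBanachSymbol (m - (j : ℝ)) (f j)) {ε : ℕ → ℝ} (hε : ∀ j, 0 < ε j) (M : ℕ)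
    (hsmall : ∀ k j, M ≤ j → k ≤ j → ∀ ξ,
      ‖iteratedFDeriv ℝ k (fun ξ => χ (ε j • ξ) • f j ξ) ξ‖ ≤
        (1 / 2) ^ j * (1 + ‖ξ‖) ^ (m - (j : ℝ) + 1 - (k : ℝ)))
    (N : ℕ) {r : E → F} (hr : ∀ J : ℕ, N ≤ J → ∀ ξ, ‖ξ‖ < J →
      r ξ = ∑ j ∈ Finset.range J, (χ (ε j • ξ) - if j < N then 1 else 0) • f j ξ) :
    IsBanachSymbol (m - (N : ℝ)) r := by
  refine IsBanachSymbol.of_locallyFinite_sum (fun j => ?_) (fun k => ?_) hr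
  · have h := IsBanachSymbol.cutoff_sub_one_smul hχ hc (hε j).ne' (hf j).1 (m - (N : ℝ))
    rcases lt_or_ge j N with hj | hj
    · simpa only [if_pos hj] using h
    · have hjN : (N : ℝ) ≤ j := by exact_mod_cast hj
      convert ((hf j).mono (by linarith : m - (j : ℝ) ≤ m - N)).add h using 1
      funext ξ
      simp [if_neg hj.not_gt, sub_smul]
  · refine ⟨max (N + 1) (max k M), fun j hj ξ => ?_⟩
    obtain ⟨hjN, hjk, hjM⟩ : N + 1 ≤ j ∧ k ≤ j ∧ M ≤ j := by simpa using hj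
    have hjN' : (N : ℝ) + 1 ≤ j := by exact_mod_cast hjN
    have hN : ¬ j < N := by omega
    simp only [if_neg hN, sub_zero]
    refine (hsmall k j hjM hjk ξ).trans ?_
    gcongr
    · exact one_le_one_add_norm ξ
    · linarith

end BorelSummation

section AsymptoticSums

variable {αa : Rn n → (A ≃⋆ₐ[ℂ] A)}

namespace IsIsometricAction

variable (hα : IsIsometricAction αa)

include hα

theorem isSymbol_mono {p q : ℝ} {ρ : Rn n → A} (hρ : IsSymbol αa p ρ) (hpq : p ≤ q) :
    IsSymbol αa q ρ := by
  rw [hα.isSymbol_iff] at hρ ⊢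
  exact ⟨hρ.1, fun a => (hρ.2 a).mono hpq⟩

theorem δpow_sub {u v : A} (hu : u ∈ SmoothSet αa) (hv : v ∈ SmoothSet αa) (a : Fin n → ℕ) :
    δpow αa a (u - v) = δpow αa a u - δpow αa a v := by
  have h := hα.δpow_smul_sum (s := Finset.univ) ![1, -1] (u := ![u, v])
    (fun i => by fin_cases i <;> simpa) a
  simpa [sub_eq_add_neg] using h

theorem isSymbol_sub {p : ℝ} {ρ σ : Rn n → A} (hρ : IsSymbol αa p ρ) (hσ : IsSymbol αa p σ) :
    IsSymbol αa p (ρ - σ) := by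
  rw [hα.isSymbol_iff] at hρ hσ ⊢
  refine ⟨fun ξ => ?_, fun a => ?_⟩
  · simpa using smul_sub_mem_smoothSet 1 (hρ.1 ξ) (hσ.1 ξ)
  · convert (hρ.2 a).sub (hσ.2 a) using 1
    funext ξ
    exact hα.δpow_sub (hρ.1 ξ) (hσ.1 ξ) a

/-- Existence of asymptotic sums, including the trivial truncation `N = 0`. -/
theorem exists_asymptotic_sum {m : ℝ} {ρh : ℕ → Rn n → A}
    (hρh : ∀ j : ℕ, IsSymbol αa (m - j) (ρh j)) :
    ∃ ρ : Rn n → A, ∀ N : ℕ, IsSymbol αa (m - N) (ρ - ∑ j ∈ Finset.range N, ρh j) := by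
  have hsm : ∀ j ξ, ρh j ξ ∈ SmoothSet αa := fun j => (hρh j).1
  have hB : ∀ (a : Fin n → ℕ) (j : ℕ),
      IsBanachSymbol (m - (j : ℝ)) fun ξ => δpow αa a (ρh j ξ) :=
    fun a j => (hα.isSymbol_iff.1 (hρh j)).2 a
  obtain ⟨χ, hχ, hχ0, hχc⟩ := exists_cutoff (Rn n)
  obtain ⟨ε, hε, hsmall⟩ :=
    IsBanachSymbol.exists_cutoff_scales (IsBanachSymbol.of_cutoff hχ hχc) (fun ξ h => hχ0 ξ h.le) hB
  have hzero : ∀ (J : ℕ) (ξ : Rn n), ‖ξ‖ < J → ∀ j ∉ Finset.range J,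
      χ (ε j • ξ) • ρh j ξ = 0 := by
    intro J ξ hξ j hj
    have hJj : (J : ℝ) ≤ j := by exact_mod_cast not_lt.1 (mt Finset.mem_range.2 hj)
    rw [hχ0 _ ?_, zero_smul]
    rw [norm_smul, Real.norm_of_nonneg (hε j).1.le]
    calc ε j * ‖ξ‖ ≤ 1 / ((j : ℝ) + 1) * ((j : ℝ) + 1) := by
          gcongr
          · exact (hε j).2
          · linarith
      _ = 1 := one_div_mul_cancel (by positivity)
  refine ⟨fun ξ => ∑' j, χ (ε j • ξ) • ρh j ξ, fun N => ?_⟩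
  have hval : ∀ J : ℕ, N ≤ J → ∀ ξ, ‖ξ‖ < J →
      ((fun ξ => ∑' j, χ (ε j • ξ) • ρh j ξ) - ∑ j ∈ Finset.range N, ρh j) ξ =
        ∑ j ∈ Finset.range J, (χ (ε j • ξ) - if j < N then 1 else 0) • ρh j ξ := by
    intro J hJ ξ hξ
    have hN : ∑ j ∈ Finset.range N, ρh j ξ =
        ∑ j ∈ Finset.range J, (if j < N then (1 : ℝ) else 0) • ρh j ξ := by
      simp only [ite_smul, one_smul, zero_smul, ← Finset.sum_filter]
      congr 1
      ext j
      simp only [Finset.mem_filter, Finset.mem_range]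
      omega
    simp only [Pi.sub_apply, Finset.sum_apply, sub_smul, Finset.sum_sub_distrib]
    rw [tsum_eq_sum (hzero J ξ hξ), hN]
  refine hα.isSymbol_iff.2 ⟨fun ξ => ?_, fun a => ?_⟩
  · obtain ⟨J, hJ⟩ := exists_nat_gt ‖ξ‖
    rw [hval (max N J) (le_max_left _ _) ξ (hJ.trans_le (by exact_mod_cast le_max_right N J))]
    exact smul_sum_mem_smoothSet _ fun j => hsm j ξ
  · refine IsBanachSymbol.of_cutoff_sum hχ hχc (hB a) (fun j => (hε j).1)
      (Encodable.encode a) (fun k j => hsmall a k j) N fun J hJ ξ hξ => ?_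
    rw [hval J hJ ξ hξ, hα.δpow_smul_sum _ (fun j => hsm j ξ)]

end IsIsometricAction

end AsymptoticSums

/-- Borel lemma for symbols: given `ρ_{m-j} ∈ 𝕊^{m-j}(ℝⁿ;𝒜_θ)`, `j ≥ 0`,
there is `ρ ∈ 𝕊^m(ℝⁿ;𝒜_θ)` with `ρ ∼ Σ_j ρ_{m-j}`, i.e.
`ρ − Σ_{j<N} ρ_{m-j} ∈ 𝕊^{m-N}(ℝⁿ;𝒜_θ)` for all `N ≥ 1`; moreover `ρ` is unique modulo
`𝒮(ℝⁿ;𝒜_θ)`. -/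
theorem statement_11
    {n : ℕ} (hn : 2 ≤ n)
    {A : Type} [NormedRing A] [StarRing A] [CStarRing A] [NormedAlgebra ℂ A]
    [StarModule ℂ A] [CompleteSpace A]
    (αa : Rn n → (A ≃⋆ₐ[ℂ] A))
    (hαadd : ∀ s t (u : A), αa (s + t) u = αa s (αa t u))
    (hα0 : ∀ u : A, αa 0 u = u)
    (hαiso : ∀ s (u : A), ‖αa s u‖ = ‖u‖)
    (m : ℝ) (ρh : ℕ → Rn n → A)
    (hρh : ∀ j : ℕ, IsSymbol αa (m - j) (ρh j)) :
    -- existence of an asymptotic sum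
    (∃ ρ : Rn n → A, IsSymbol αa m ρ ∧
      ∀ N : ℕ, 1 ≤ N →
        IsSymbol αa (m - N) (ρ - ∑ j ∈ Finset.range N, ρh j)) ∧
    -- uniqueness modulo `𝒮(ℝⁿ;𝒜_θ)`
    (∀ ρ ρ' : Rn n → A, IsSymbol αa m ρ → IsSymbol αa m ρ' →
      (∀ N : ℕ, 1 ≤ N → IsSymbol αa (m - N) (ρ - ∑ j ∈ Finset.range N, ρh j)) →
      (∀ N : ℕ, 1 ≤ N → IsSymbol αa (m - N) (ρ' - ∑ j ∈ Finset.range N, ρh j)) →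
      IsSchwartzSym αa (ρ - ρ')) := by
  have hα : IsIsometricAction αa := ⟨hαadd, hα0, hαiso⟩
  refine ⟨?_, fun ρ ρ' _ _ h h' m' => ?_⟩
  · obtain ⟨ρ, hρ⟩ := hα.exists_asymptotic_sum hρh
    exact ⟨ρ, by simpa using hρ 0, fun N _ => hρ N⟩
  · obtain ⟨N, hN⟩ := exists_nat_ge (m - m')
    have hN1 : 1 ≤ N + 1 := Nat.le_add_left 1 N
    have hsub := hα.isSymbol_sub (h (N + 1) hN1) (h' (N + 1) hN1)
    rw [sub_sub_sub_cancel_right] at hsub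
    exact hα.isSymbol_mono hsub (by push_cast; linarith)
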